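/- arXiv:1902.03855 — 2 statements merged into one kernel-verified Lean document; each statement's English description precedes it below -/
import Mathlib

section
/- For every n ≥ 1 there exists a graph B on exactly n·2^{n−1} vertices such that every graph A on n vertices admits a graph embedding ψ : A → B with the property that every partial automorphism of ψ(A) extends to an automorphism of B. In particular, every graph on n vertices has an EPPA-witness on at most n·2^{n−1} vertices, and this witness can be chosen uniformly over all graphs on n vertices. -/
set_option autoImplicit false

universe u

namespace EPPA

/-- A partial automorphism of the induced subgraph of `G` on the vertex set `S`. -/
structure GraphPartialAut {V : Type u} (G : SimpleGraph V) (S : Set V) where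
  dom : Set V
  ran : Set V
  dom_subset : dom ⊆ S
  ran_subset : ran ⊆ S
  f : V → V
  maps_mem : ∀ x ∈ dom, f x ∈ ran
  injOn : ∀ x ∈ dom, ∀ y ∈ dom, f x = f y → x = y
  surjOn : ∀ y ∈ ran, ∃ x ∈ dom, f x = y
  adj_iff : ∀ x ∈ dom, ∀ y ∈ dom, G.Adj (f x) (f y) ↔ G.Adj x y

/-- Pairs `(i, χ)` of an index `i` and a valuation `χ : I → Bool` with `χ i = false`. -/
abbrev ValuedVertex (I : Type*) : Type _ := {p : I × (I → Bool) // p.2 p.1 = false}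

/-- The graph on valued vertices in which `(i, χ)` and `(j, ξ)` are adjacent if and only if
`χ j ≠ ξ i`. -/
def valuationGraph (I : Type*) : SimpleGraph (ValuedVertex I) where
  Adj p q := p.1.2 q.1.1 ≠ q.1.2 p.1.1
  symm := ⟨fun _ _ h => h.symm⟩
  loopless := ⟨fun _ h => h rfl⟩

/-- A valuation vanishing at `i` is determined by its values off `i`. -/
def valuationEquiv {I : Type*} [DecidableEq I] (i : I) :
    {χ : I → Bool // χ i = false} ≃ ({j : I // j ≠ i} → Bool) where
  toFun χ j := χ.1 j
  invFun ξ := ⟨fun j => if h : j ≠ i then ξ ⟨j, h⟩ else false, by simp⟩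
  left_inv := by
    rintro ⟨χ, hχ⟩
    ext j
    by_cases h : j = i
    · subst h; simp [hχ]
    · simp [h]
  right_inv ξ := by
    ext ⟨j, h⟩
    simp [h]

theorem card_valuedVertex (I : Type*) [Fintype I] :
    Nat.card (ValuedVertex I) = Fintype.card I * 2 ^ (Fintype.card I - 1) := by
  classical
  have e : ValuedVertex I ≃ Σ i : I, ({j : I // j ≠ i} → Bool) :=
    (Equiv.subtypeProdEquivSigmaSubtype fun (i : I) (χ : I → Bool) => χ i = false).trans
      (Equiv.sigmaCongrRight valuationEquiv)
  rw [Nat.card_congr e, Nat.card_eq_fintype_card, Fintype.card_sigma]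
  simp [Fintype.card_subtype_compl]

/-- The automorphism of the valuation graph which permutes the indices by `π` and flips the
valuations along the symmetric relation `F`. -/
def flipIso {I : Type*} (π : Equiv.Perm I) (F : I → I → Bool) (F_self : ∀ i, F i i = false)
    (F_comm : ∀ i j, F i j = F j i) : valuationGraph I ≃g valuationGraph I where
  toFun p := ⟨(π p.1.1, fun j => xor (p.1.2 (π.symm j)) (F p.1.1 (π.symm j))), by
    simp [p.2, F_self]⟩
  invFun p := ⟨(π.symm p.1.1, fun j => xor (p.1.2 (π j)) (F (π.symm p.1.1) j)), by
    simp [p.2, F_self]⟩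
  left_inv p := by
    ext <;> simp
  right_inv p := by
    ext <;> simp
  map_rel_iff' {p q} := by
    simp [valuationGraph, F_comm q.1.1 p.1.1]

section Embedding

variable {I : Type*} [LinearOrder I] (A : SimpleGraph I)

open Classical in
/-- The valuation at `i` recording the neighbours of `i` below `i`. -/
noncomputable def lowerNeighbors (i j : I) : Bool := decide (j < i ∧ A.Adj i j)

theorem lowerNeighbors_self (i : I) : lowerNeighbors A i i = false := by
  simp [lowerNeighbors]

theorem lowerNeighbors_ne_iff (i j : I) :
    lowerNeighbors A i j ≠ lowerNeighbors A j i ↔ A.Adj i j := by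
  rcases lt_trichotomy i j with h | rfl | h
  · simp [lowerNeighbors, h, h.not_gt, A.adj_comm j i]
  · simp
  · simp [lowerNeighbors, h, h.not_gt]

/-- The embedding of a graph on `I` into the valuation graph given by lower neighbours. -/
noncomputable def valuationEmbedding : A ↪g valuationGraph I where
  toFun i := ⟨(i, lowerNeighbors A i), lowerNeighbors_self A i⟩
  inj' _ _ h := congrArg (fun p : ValuedVertex I => p.1.1) h
  map_rel_iff' := lowerNeighbors_ne_iff A _ _

theorem exists_iso_extends [Finite I]
    (p : GraphPartialAut (valuationGraph I) (Set.range (valuationEmbedding A))) :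
    ∃ θ : valuationGraph I ≃g valuationGraph I, ∀ x ∈ p.dom, θ x = p.f x := by
  classical
  have := Fintype.ofFinite I
  let ψ := valuationEmbedding A
  let D : Finset I := {i | ψ i ∈ p.dom}
  have mem_D (i : I) : i ∈ D ↔ ψ i ∈ p.dom := by simp [D]
  let g : I → I := fun i => (p.f (ψ i)).1.1
  have hg : ∀ i ∈ D, p.f (ψ i) = ψ (g i) := by
    intro i hi
    obtain ⟨k, hk⟩ := p.ran_subset (p.maps_mem _ ((mem_D i).1 hi))
    have : g i = k := by simp only [g, ← hk]; rfl
    rw [this, hk]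
  have g_inj : Set.InjOn g D := by
    intro i hi j hj h
    refine ψ.injective (p.injOn _ ((mem_D i).1 hi) _ ((mem_D j).1 hj) ?_)
    rw [hg i hi, hg j hj, h]
  obtain ⟨π, hπ⟩ := Finset.exists_equiv_extend_of_card_eq (t := Finset.univ) rfl
    (Finset.subset_univ (D.image g)) g_inj
  let σ : Equiv.Perm I := π.trans (Equiv.subtypeUnivEquiv Finset.mem_univ)
  have hσ : ∀ i ∈ D, σ i = g i := hπ
  have adj_σ : ∀ i ∈ D, ∀ j ∈ D, A.Adj (σ i) (σ j) ↔ A.Adj i j := by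
    intro i hi j hj
    have h := p.adj_iff _ ((mem_D i).1 hi) _ ((mem_D j).1 hj)
    rwa [hg i hi, hg j hj, ← hσ i hi, ← hσ j hj, ψ.map_adj_iff, ψ.map_adj_iff] at h
  let c : I → I → Bool := fun i j =>
    xor (lowerNeighbors A i j) (lowerNeighbors A (σ i) (σ j))
  have c_comm : ∀ i ∈ D, ∀ j ∈ D, c i j = c j i := by
    intro i hi j hj
    have h := adj_σ i hi j hj
    rw [← lowerNeighbors_ne_iff, ← lowerNeighbors_ne_iff] at h
    exact (by decide : ∀ a a' b b' : Bool, (b ≠ b' ↔ a ≠ a') → xor a b = xor a' b') _ _ _ _ h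
  let F : I → I → Bool := fun i j =>
    if i ∈ D then c i j else if j ∈ D then c j i else false
  have F_self (i : I) : F i i = false := by
    simp [F, c, lowerNeighbors_self]
  have F_comm (i j : I) : F i j = F j i := by
    simp only [F]
    split_ifs with hi hj <;> first | rfl | exact c_comm i hi j hj
  refine ⟨flipIso σ F F_self F_comm, fun x hx => ?_⟩
  obtain ⟨i, rfl⟩ := p.dom_subset hx
  have hi : i ∈ D := (mem_D i).2 hx
  rw [hg i hi, ← hσ i hi]
  refine Subtype.ext (Prod.ext rfl (funext fun j => ?_))
  change xor (lowerNeighbors A i (σ.symm j)) (F i (σ.symm j)) = lowerNeighbors A (σ i) j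
  simp [F, c, hi]

end Embedding

/-- **A uniform EPPA-witness on `n·2^(n-1)` vertices.** For every `n ≥ 1` there is a
graph `B` on exactly `n·2^(n-1)` vertices such that every graph `A` on `n` vertices
admits a graph embedding `ψ : A → B` for which every partial automorphism of `ψ(A)`
extends to an automorphism of `B`. -/
theorem uniform_graph_eppa_witness (n : ℕ) (hn : 1 ≤ n) :
    ∃ (W : Type) (B : SimpleGraph W), Finite W ∧ Nat.card W = n * 2 ^ (n - 1) ∧
      ∀ (V : Type u) [Fintype V], Fintype.card V = n →
        ∀ A : SimpleGraph V, ∃ ψ : A ↪g B,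
          ∀ p : GraphPartialAut B (Set.range ⇑ψ),
            ∃ θ : B ≃g B, ∀ x ∈ p.dom, θ x = p.f x := by
  refine ⟨ValuedVertex (Fin n), valuationGraph (Fin n), inferInstance, ?_, ?_⟩
  · simpa using card_valuedVertex (Fin n)
  · intro V _ hV A
    let e : Fin n ≃ V := (Fintype.equivFinOfCardEq hV).symm
    let φ : A ≃g A.comap e := (SimpleGraph.Iso.comap e A).symm
    let ψ : A ↪g valuationGraph (Fin n) := φ.toEmbedding.trans (valuationEmbedding (A.comap e))
    have hψ : Set.range ψ = Set.range (valuationEmbedding (A.comap e)) :=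
      φ.surjective.range_comp (valuationEmbedding (A.comap e))
    refine ⟨ψ, ?_⟩
    rw [hψ]
    exact exists_iso_extends (A.comap e)

end EPPA
end

section
/- Fix k ≥ 1. A k-orientation is a finite directed graph with no loops and at most one directed edge between any ordered pair of distinct vertices, in which every vertex has out-degree at most k. Call a set S of vertices of a k-orientation closed if every vertex reachable from a vertex of S by a directed path belongs to S. Then for every k-orientation A there is a k-orientation B and an isomorphism ψ from A onto the subdigraph of B induced on a closed subset of B, such that every isomorphism between subdigraphs of ψ(A) induced on closed subsets of B contained in ψ(A) extends to an automorphism of B; moreover, the extensions can be chosen coherently (the extension map sends coherent triples of such partial isomorphisms to coherent triples in Aut(B)). -/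
set_option autoImplicit false

universe u

namespace EPPA

/-- A partial isomorphism of the digraph `(V, E)`: an isomorphism between two induced
subdigraphs, recorded by its domain, its range and its underlying map. -/
structure PartialDigraphIso {V : Type u} (E : V → V → Prop) where
  dom : Set V
  ran : Set V
  f : V → V
  maps_mem : ∀ x ∈ dom, f x ∈ ran
  injOn : ∀ x ∈ dom, ∀ y ∈ dom, f x = f y → x = y
  surjOn : ∀ y ∈ ran, ∃ x ∈ dom, f x = y
  edge_iff : ∀ x ∈ dom, ∀ y ∈ dom, E (f x) (f y) ↔ E x y

/-- A set `S` of vertices of the digraph `(V, E)` is closed if every vertex reachable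
by a directed path from a vertex of `S` belongs to `S`. -/
def IsClosedSet {V : Type u} (E : V → V → Prop) (S : Set V) : Prop :=
  ∀ x ∈ S, ∀ y, Relation.ReflTransGen E x y → y ∈ S

/-- `(V, E)` is a `k`-orientation: a loopless digraph in which every vertex has
out-degree at most `k`. -/
def IsKOrientation {V : Type u} (E : V → V → Prop) (k : ℕ) : Prop :=
  (∀ x, ¬E x x) ∧ ∀ x, {y | E x y}.ncard ≤ k

/-- Partial bijections between subsets of a finite type can be extended to permutations of the
type in a way which respects composition. -/
theorem exists_coherent_perm_extension (V : Type u) [Finite V] :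
    ∃ F : Set V → Set V → (V → V) → Equiv.Perm V,
      (∀ D R f, Set.BijOn f D R → Set.EqOn (F D R f) f D) ∧
        ∀ D R S f g h, Set.BijOn f D R → Set.BijOn g R S → Set.EqOn h (g ∘ f) D →
          ∀ x, F D S h x = F R S g (F D R f x) := by
  classical
  have hcard : ∀ {D R : Set V} {f : V → V}, Set.BijOn f D R →
      Nat.card ↥Dᶜ = Nat.card ↥Rᶜ := by
    intro D R f h
    have h₁ : D.ncard = R.ncard := Nat.card_congr (h.equiv f)
    have h₂ := Set.ncard_add_ncard_compl D
    have h₃ := Set.ncard_add_ncard_compl R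
    simp only [Nat.card_coe_set_eq]
    omega
  let c : ∀ {D R : Set V} {f : V → V}, Set.BijOn f D R → (↥Dᶜ ≃ ↥Rᶜ) := fun h =>
    ((Finite.equivFin _).trans (finCongr (hcard h))).trans (Finite.equivFin _).symm
  let F : Set V → Set V → (V → V) → Equiv.Perm V := fun D R f =>
    if h : Set.BijOn f D R then
      (Equiv.Set.sumCompl D).symm.trans
        ((Equiv.sumCongr (h.equiv f) (c h)).trans (Equiv.Set.sumCompl R))
    else 1
  have hF : ∀ {D R f} (_ : Set.BijOn f D R) {x}, x ∈ D → F D R f x = f x := by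
    intro D R f h x hx
    simp [F, h, Equiv.Set.sumCompl_symm_apply_of_mem hx, Set.BijOn.equiv]
  have hF' : ∀ {D R f} (h : Set.BijOn f D R) {x} (hx : x ∈ Dᶜ), F D R f x = c h ⟨x, hx⟩ := by
    intro D R f h x hx
    simp [F, h, Equiv.Set.sumCompl_symm_apply_of_notMem hx]
  refine ⟨F, fun D R f h x hx => hF h hx, fun D R S f g h hf hg hh x => ?_⟩
  have hgf : Set.BijOn h D S := (hg.comp hf).congr hh.symm
  by_cases hx : x ∈ D
  · rw [hF hgf hx, hF hf hx, hF hg (hf.mapsTo hx), hh hx, Function.comp_apply]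
  · rw [hF' hgf hx, hF' hf hx, hF' hg (c hf ⟨x, hx⟩).2]
    refine congrArg (fun i => ((Finite.equivFin ↥Sᶜ).symm i : V)) (Fin.ext ?_)
    exact (congrArg Fin.val ((Finite.equivFin ↥Rᶜ).apply_symm_apply
      (finCongr (hcard hf) (Finite.equivFin ↥Dᶜ ⟨x, hx⟩)))).symm

section Reachable

variable {V : Type u}

/-- The edges of `E` which start at a vertex reachable from `x`. -/
def reachableEdges (E : V → V → Prop) (x : V) : V → V → Prop :=
  fun a b => Relation.ReflTransGen E x a ∧ E a b

/-- The digraph of rooted digraphs on `V`: there is an edge from `(x, R)`, where `x` has at most `k`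
out-neighbours in `R`, to `(y, R')` if `y` is an out-neighbour of `x` in `R` and `R'` is the part
of `R` reachable from `y`. -/
def rootedEdge (k : ℕ) (s t : V × (V → V → Prop)) : Prop :=
  s.1 ≠ t.1 ∧ s.2 s.1 t.1 ∧ t.2 = reachableEdges s.2 t.1 ∧ {y | s.2 s.1 y}.ncard ≤ k

theorem isKOrientation_rootedEdge [Finite V] (k : ℕ) :
    IsKOrientation (rootedEdge (V := V) k) k := by
  refine ⟨fun s h => h.1 rfl, fun s => ?_⟩
  by_cases hs : {y | s.2 s.1 y}.ncard ≤ k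
  · refine le_trans (Set.ncard_le_ncard (t := (fun y => (y, reachableEdges s.2 y)) ''
      {y | s.2 s.1 y}) ?_) ((Set.ncard_image_le).trans hs)
    rintro ⟨y, R⟩ ⟨-, h, h', -⟩
    exact ⟨y, h, Prod.ext rfl h'.symm⟩
  · simp [rootedEdge, hs]

/-- The action of permutations of `V` on rooted digraphs on `V`. -/
def rootedPerm (g : Equiv.Perm V) : Equiv.Perm (V × (V → V → Prop)) :=
  g.prodCongr (g.arrowCongr (g.arrowCongr (Equiv.refl Prop)))

theorem rootedPerm_apply (g : Equiv.Perm V) (s : V × (V → V → Prop)) :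
    rootedPerm g s = (g s.1, fun a b => s.2 (g.symm a) (g.symm b)) := rfl

theorem reflTransGen_comap_iff (g : Equiv.Perm V) (E : V → V → Prop) (a b : V) :
    Relation.ReflTransGen (fun a b => E (g a) (g b)) a b ↔
      Relation.ReflTransGen E (g a) (g b) := by
  refine ⟨fun h => h.lift g fun _ _ => id, fun h => ?_⟩
  simpa [Function.onFun] using h.lift (p := fun a b => E (g a) (g b)) g.symm
    fun _ _ h => by simpa [Function.onFun] using h

theorem rootedEdge_rootedPerm_iff (k : ℕ) (g : Equiv.Perm V) (s t : V × (V → V → Prop)) :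
    rootedEdge k (rootedPerm g s) (rootedPerm g t) ↔ rootedEdge k s t := by
  have h₁ : {y | s.2 s.1 (g.symm y)}.ncard = {y | s.2 s.1 y}.ncard := by
    have : {y | s.2 s.1 (g.symm y)} = g '' {y | s.2 s.1 y} := by
      rw [Equiv.image_eq_preimage_symm]; rfl
    rw [this, Set.ncard_image_of_injective _ g.injective]
  have h₂ : (fun a b => t.2 (g.symm a) (g.symm b)) =
      reachableEdges (fun a b => s.2 (g.symm a) (g.symm b)) (g t.1) ↔
      t.2 = reachableEdges s.2 t.1 := by
    have h₃ : reachableEdges (fun a b => s.2 (g.symm a) (g.symm b)) (g t.1) =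
        fun a b => reachableEdges s.2 t.1 (g.symm a) (g.symm b) := by
      ext a b
      simp [reachableEdges, reflTransGen_comap_iff g.symm]
    rw [h₃]
    refine ⟨fun h => ?_, fun h => by rw [h]⟩
    ext a b
    simpa using congrFun (congrFun h (g a)) (g b)
  simp only [rootedEdge, rootedPerm_apply, Equiv.symm_apply_apply, h₁, h₂, ne_eq,
    EmbeddingLike.apply_eq_iff_eq]

theorem reachableEdges_self_iff (E : V → V → Prop) (x y : V) :
    reachableEdges E x x y ↔ E x y :=
  and_iff_right .refl

theorem reachableEdges_reachableEdges {E : V → V → Prop} {x y : V} (h : E x y) :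
    reachableEdges (reachableEdges E x) y = reachableEdges E y := by
  have key : ∀ a, Relation.ReflTransGen E y a →
      Relation.ReflTransGen (reachableEdges E x) y a := by
    intro a ha
    induction ha with
    | refl => exact .refl
    | tail hb hbc ih => exact ih.tail ⟨.head h hb, hbc⟩
  ext a b
  refine ⟨fun hab => ⟨hab.1.lift id fun _ _ h => h.2, hab.2.2⟩, fun hab => ?_⟩
  exact ⟨key a hab.1, .head h hab.1, hab.2⟩

/-- The embedding of a digraph into the digraph of rooted digraphs on its vertex set. -/
def rootedEmbed (E : V → V → Prop) (x : V) : V × (V → V → Prop) :=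
  (x, reachableEdges E x)

theorem rootedEdge_rootedEmbed_iff {k : ℕ} {E : V → V → Prop} (hE : IsKOrientation E k) (x : V)
    (t : V × (V → V → Prop)) :
    rootedEdge k (rootedEmbed E x) t ↔ E x t.1 ∧ t = rootedEmbed E t.1 := by
  simp only [rootedEdge, rootedEmbed, reachableEdges_self_iff]
  constructor
  · rintro ⟨-, h, h', -⟩
    exact ⟨h, Prod.ext rfl (h'.trans (reachableEdges_reachableEdges h))⟩
  · rintro ⟨h, h'⟩
    refine ⟨fun e => hE.1 _ (e ▸ h), h, ?_, hE.2 x⟩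
    rw [reachableEdges_reachableEdges h]
    exact congrArg Prod.snd h'

theorem rootedPerm_rootedEmbed {E : V → V → Prop} {D : Set V} {g : Equiv.Perm V}
    (hD : ∀ x ∈ D, ∀ y, E x y → y ∈ D) (hg : ∀ x ∈ D, ∀ y, E (g x) (g y) ↔ E x y)
    {x : V} (hx : x ∈ D) :
    rootedPerm g (rootedEmbed E x) = rootedEmbed E (g x) := by
  have h₁ : ∀ a, Relation.ReflTransGen E x a →
      a ∈ D ∧ Relation.ReflTransGen E (g x) (g a) := by
    intro a ha
    induction ha with
    | refl => exact ⟨hx, .refl⟩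
    | tail _ hbc ih => exact ⟨hD _ ih.1 _ hbc, ih.2.tail ((hg _ ih.1 _).2 hbc)⟩
  have h₂ : ∀ a, Relation.ReflTransGen E (g x) a → Relation.ReflTransGen E x (g.symm a) := by
    intro a ha
    induction ha with
    | refl => simpa using .refl
    | tail _ hbc ih => exact ih.tail ((hg _ (h₁ _ ih).1 _).1 (by simpa using hbc))
  refine Prod.ext rfl ?_
  ext a b
  constructor
  · rintro ⟨ha, hab⟩
    obtain ⟨haD, ha'⟩ := h₁ _ ha
    have := (hg _ haD _).2 hab
    simp only [Equiv.apply_symm_apply] at ha' this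
    exact ⟨ha', this⟩
  · rintro ⟨ha, hab⟩
    have ha' := h₂ _ ha
    exact ⟨ha', (hg _ (h₁ _ ha').1 _).1 (by simpa using hab)⟩

end Reachable

/-- The map induced on `V` by a partial isomorphism of the digraph of rooted digraphs on `V`. -/
def PartialDigraphIso.rootMap {V : Type u} {k : ℕ}
    (p : PartialDigraphIso (rootedEdge (V := V) k)) (E : V → V → Prop) (x : V) : V :=
  (p.f (rootedEmbed E x)).1

section RootMap

variable {V : Type u} {k : ℕ} {E : V → V → Prop} (p : PartialDigraphIso (rootedEdge (V := V) k))

theorem PartialDigraphIso.rootedEmbed_rootMap (hr : p.ran ⊆ Set.range (rootedEmbed E)) {x : V}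
    (hx : rootedEmbed E x ∈ p.dom) :
    rootedEmbed E (p.rootMap E x) = p.f (rootedEmbed E x) := by
  obtain ⟨y, hy⟩ := hr (p.maps_mem _ hx)
  rw [PartialDigraphIso.rootMap, ← hy]
  rfl

theorem PartialDigraphIso.bijOn_rootMap (hd : p.dom ⊆ Set.range (rootedEmbed E))
    (hr : p.ran ⊆ Set.range (rootedEmbed E)) :
    Set.BijOn (p.rootMap E) (rootedEmbed E ⁻¹' p.dom) (rootedEmbed E ⁻¹' p.ran) := by
  refine ⟨fun x hx => ?_, fun x hx y hy h => ?_, fun y hy => ?_⟩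
  · rw [Set.mem_preimage, p.rootedEmbed_rootMap hr hx]
    exact p.maps_mem _ hx
  · refine congrArg Prod.fst (p.injOn _ hx _ hy ?_)
    rw [← p.rootedEmbed_rootMap hr hx, ← p.rootedEmbed_rootMap hr hy, h]
  · obtain ⟨s, hs, hsy⟩ := p.surjOn _ hy
    obtain ⟨x, rfl⟩ := hd hs
    exact ⟨x, hs, congrArg Prod.fst hsy⟩

theorem PartialDigraphIso.rootedPerm_eq (hE : IsKOrientation E k)
    (hd : p.dom ⊆ Set.range (rootedEmbed E)) (hr : p.ran ⊆ Set.range (rootedEmbed E))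
    (hdc : IsClosedSet (rootedEdge k) p.dom) (hrc : IsClosedSet (rootedEdge k) p.ran)
    {g : Equiv.Perm V} (hg : Set.EqOn g (p.rootMap E) (rootedEmbed E ⁻¹' p.dom)) :
    ∀ s ∈ p.dom, rootedPerm g s = p.f s := by
  have hedge : ∀ x y, rootedEdge k (rootedEmbed E x) (rootedEmbed E y) ↔ E x y := fun x y =>
    (rootedEdge_rootedEmbed_iff hE x _).trans (and_iff_left rfl)
  have hgf : ∀ x, rootedEmbed E x ∈ p.dom → rootedEmbed E (g x) = p.f (rootedEmbed E x) :=
    fun x hx => by rw [hg hx, p.rootedEmbed_rootMap hr hx]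
  have hD : ∀ x ∈ rootedEmbed E ⁻¹' p.dom, ∀ y, E x y → y ∈ rootedEmbed E ⁻¹' p.dom :=
    fun x hx y h => hdc _ hx _ (.single ((hedge x y).2 h))
  have key : ∀ x ∈ rootedEmbed E ⁻¹' p.dom, ∀ y ∈ rootedEmbed E ⁻¹' p.dom,
      (E (g x) (g y) ↔ E x y) := fun x hx y hy => by
    rw [← hedge, hgf x hx, hgf y hy, p.edge_iff _ hx _ hy, hedge]
  intro s hs
  obtain ⟨x, rfl⟩ := hd hs
  rw [rootedPerm_rootedEmbed hD (fun a ha b => ?_) hs, hgf x hs]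
  refine ⟨fun h => ?_, fun h => (key a ha b (hD a ha b h)).2 h⟩
  have hb : rootedEmbed E (g b) ∈ p.ran :=
    hrc _ (by rw [hgf a ha]; exact p.maps_mem _ ha) _ (.single ((hedge _ _).2 h))
  obtain ⟨c, hc, hcb⟩ := (p.bijOn_rootMap hd hr).surjOn hb
  rw [← hg hc] at hcb
  obtain rfl := g.injective hcb
  exact (key a ha c hc).1 h

end RootMap

/-- **Coherent EPPA for `k`-orientations with closures.** For every finite
`k`-orientation `A` there is a finite `k`-orientation `B` and an isomorphism `ψ` of
`A` onto the subdigraph of `B` induced on a closed subset, such that every isomorphism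
between subdigraphs of `ψ(A)` induced on closed subsets of `B` contained in `ψ(A)`
extends to an automorphism of `B`, coherently. -/
theorem korientations_coherent_eppa (k : ℕ) (hk : 1 ≤ k)
    (VA : Type u) [Finite VA] (EA : VA → VA → Prop) (hA : IsKOrientation EA k) :
    ∃ (VB : Type u) (EB : VB → VB → Prop), Finite VB ∧ IsKOrientation EB k ∧
      ∃ ψ : VA → VB, Function.Injective ψ ∧ IsClosedSet EB (Set.range ψ) ∧
        (∀ x y, EB (ψ x) (ψ y) ↔ EA x y) ∧
        ∃ ext : ∀ p : PartialDigraphIso EB,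
            p.dom ⊆ Set.range ψ → p.ran ⊆ Set.range ψ →
            IsClosedSet EB p.dom → IsClosedSet EB p.ran → (VB ≃ VB),
          (∀ p h₁ h₂ h₃ h₄, ∀ x y : VB,
              EB (ext p h₁ h₂ h₃ h₄ x) (ext p h₁ h₂ h₃ h₄ y) ↔ EB x y) ∧
            (∀ p h₁ h₂ h₃ h₄, ∀ x ∈ p.dom, ext p h₁ h₂ h₃ h₄ x = p.f x) ∧
            ∀ p q r hp₁ hp₂ hp₃ hp₄ hq₁ hq₂ hq₃ hq₄ hr₁ hr₂ hr₃ hr₄,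
              p.dom = r.dom → p.ran = q.dom → q.ran = r.ran →
              (∀ x ∈ p.dom, r.f x = q.f (p.f x)) →
              ∀ x, ext r hr₁ hr₂ hr₃ hr₄ x =
                ext q hq₁ hq₂ hq₃ hq₄ (ext p hp₁ hp₂ hp₃ hp₄ x) := by
  obtain ⟨F, hF, hFc⟩ := exists_coherent_perm_extension VA
  have hclosed : IsClosedSet (rootedEdge k) (Set.range (rootedEmbed EA)) := by
    intro s hs t hst
    induction hst with
    | refl => exact hs
    | tail _ h ih =>
      obtain ⟨x, rfl⟩ := ih
      exact ⟨_, ((rootedEdge_rootedEmbed_iff hA x _).1 h).2.symm⟩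
  refine ⟨VA × (VA → VA → Prop), rootedEdge k, inferInstance, isKOrientation_rootedEdge k,
    rootedEmbed EA, fun x y h => congrArg Prod.fst h, hclosed,
    fun x y => (rootedEdge_rootedEmbed_iff hA x _).trans (and_iff_left rfl),
    fun p _ _ _ _ => rootedPerm
      (F (rootedEmbed EA ⁻¹' p.dom) (rootedEmbed EA ⁻¹' p.ran) (p.rootMap EA)), ?_, ?_, ?_⟩
  · exact fun p _ _ _ _ s t => rootedEdge_rootedPerm_iff k _ s t
  · exact fun p h₁ h₂ h₃ h₄ =>
      p.rootedPerm_eq hA h₁ h₂ h₃ h₄ (hF _ _ _ (p.bijOn_rootMap h₁ h₂))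
  · intro p q r hp₁ hp₂ _ _ hq₁ hq₂ _ _ hr₁ hr₂ _ _ hpr hpq hqr h s
    have hp := p.bijOn_rootMap hp₁ hp₂
    have hq := q.bijOn_rootMap hq₁ hq₂
    rw [hpq] at hp
    dsimp only
    rw [← hpr, ← hqr, hpq]
    have hcomp : Set.EqOn (r.rootMap EA) (q.rootMap EA ∘ p.rootMap EA)
        (rootedEmbed EA ⁻¹' p.dom) := fun x hx => by
      rw [Function.comp_apply, PartialDigraphIso.rootMap, PartialDigraphIso.rootMap, h _ hx,
        p.rootedEmbed_rootMap hp₂ hx]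
    rw [show F _ _ _ = (F _ _ _).trans (F _ _ _) from Equiv.ext (hFc _ _ _ _ _ _ hp hq hcomp)]
    rfl

end EPPA
end
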